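/- Let x0, y0, z0, phi: R -> R be smooth with x0'(0) = y0'(0) = z0'(0) = 0, and define q: R^2 -> R^3 by q(t,s) = ( t cos(phi(s)) + x0(s), t sin(phi(s)) + y0(s), (t/2)( x0(s) sin(phi(s)) - y0(s) cos(phi(s)) ) + z0(s) ). Let v1 = dq/dt (0,0), v2 = d^2 q / dt ds (0,0), v3 = d^2 q / ds^2 (0,0). Then the 3x3 determinant det( v1, v2, v3 ) equals phi'(0) * ( z0''(0) - ( x0(0) y0''(0) - y0(0) x0''(0) )/2 ). In particular, if phi'(0) is nonzero and z0''(0) - ( x0(0) y0''(0) - y0(0) x0''(0) )/2 is nonzero, then v1, v2, v3 are linearly independent. -/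

import Mathlib

/-- The parametrized sub-Riemannian minimal surface of the Heisenberg group `H¹`
generated by the curve `Γ(s) = (x0(s), y0(s), z0(s), φ(s))`. -/
noncomputable def Hsurf (x0 y0 z0 phi : ℝ → ℝ) (t s : ℝ) : Fin 3 → ℝ :=
  ![t * Real.cos (phi s) + x0 s, t * Real.sin (phi s) + y0 s,
    t / 2 * (x0 s * Real.sin (phi s) - y0 s * Real.cos (phi s)) + z0 s]

/-- The velocity of the ruling of `Hsurf` through `s`. -/
theorem deriv_Hsurf_fst (x0 y0 z0 phi : ℝ → ℝ) (t s : ℝ) (i : Fin 3) :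
    deriv (fun t => Hsurf x0 y0 z0 phi t s i) t =
      ![Real.cos (phi s), Real.sin (phi s),
        (x0 s * Real.sin (phi s) - y0 s * Real.cos (phi s)) / 2] i := by
  have affine (a b : ℝ) : deriv (fun t => t * a + b) t = a := by
    simp
  fin_cases i
  · exact affine _ _
  · exact affine _ _
  · rw [← affine ((x0 s * Real.sin (phi s) - y0 s * Real.cos (phi s)) / 2) (z0 s)]
    simp only [Hsurf]
    congr 1
    ext t
    simp
    ring

/-- The mixed second derivative of `Hsurf` at a point where `x0' = y0' = 0`. -/
theorem deriv_deriv_Hsurf_fst {x0 y0 z0 phi : ℝ → ℝ} {s : ℝ} (t : ℝ)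
    (hx : HasDerivAt x0 0 s) (hy : HasDerivAt y0 0 s) (hphi : DifferentiableAt ℝ phi s)
    (i : Fin 3) :
    deriv (fun s => deriv (fun t => Hsurf x0 y0 z0 phi t s i) t) s =
      ![-Real.sin (phi s) * deriv phi s, Real.cos (phi s) * deriv phi s,
        (x0 s * Real.cos (phi s) + y0 s * Real.sin (phi s)) / 2 * deriv phi s] i := by
  have hc := hphi.hasDerivAt.cos
  have hs := hphi.hasDerivAt.sin
  simp only [deriv_Hsurf_fst]
  fin_cases i
  · exact hc.deriv
  · exact hs.deriv
  · refine (((hx.fun_mul hs).fun_sub (hy.fun_mul hc)).div_const 2).deriv.trans ?_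
    simp
    ring

/-- At `t = 0` the surface `Hsurf` runs along its generating curve. -/
theorem Hsurf_zero (x0 y0 z0 phi : ℝ → ℝ) (i : Fin 3) :
    (fun s => Hsurf x0 y0 z0 phi 0 s i) = ![x0, y0, z0] i := by
  ext s
  fin_cases i <;> simp [Hsurf]

/-- Whitney's criterion data at a singular characteristic point of a
Heisenberg minimal surface: with `x0'(0) = y0'(0) = z0'(0) = 0`, the determinant of
`v₁ = ∂q/∂t(0,0)`, `v₂ = ∂²q/∂t∂s(0,0)`, `v₃ = ∂²q/∂s²(0,0)` equals
`φ'(0) (z0''(0) - (x0(0) y0''(0) - y0(0) x0''(0))/2)`; in particular, if both factors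
are nonzero, then `v₁, v₂, v₃` are linearly independent. -/
theorem whitney_determinant_at_singular_point
    (x0 y0 z0 phi : ℝ → ℝ)
    (hx0 : ContDiff ℝ (⊤ : ℕ∞) x0) (hy0 : ContDiff ℝ (⊤ : ℕ∞) y0)
    (hz0 : ContDiff ℝ (⊤ : ℕ∞) z0) (hphi : ContDiff ℝ (⊤ : ℕ∞) phi)
    (h1 : deriv x0 0 = 0) (h2 : deriv y0 0 = 0) (h3 : deriv z0 0 = 0) :
    Matrix.det (Matrix.of
      ![(fun i => deriv (fun t => Hsurf x0 y0 z0 phi t 0 i) 0),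
        (fun i => deriv (fun s => deriv (fun t => Hsurf x0 y0 z0 phi t s i) 0) 0),
        (fun i => deriv (deriv (fun s => Hsurf x0 y0 z0 phi 0 s i)) 0)])
      = deriv phi 0 *
        (deriv (deriv z0) 0 - (x0 0 * deriv (deriv y0) 0 - y0 0 * deriv (deriv x0) 0) / 2) ∧
    (deriv phi 0 ≠ 0 →
     deriv (deriv z0) 0 - (x0 0 * deriv (deriv y0) 0 - y0 0 * deriv (deriv x0) 0) / 2 ≠ 0 →
     LinearIndependent ℝ
      ![(fun i => deriv (fun t => Hsurf x0 y0 z0 phi t 0 i) 0),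
        (fun i => deriv (fun s => deriv (fun t => Hsurf x0 y0 z0 phi t s i) 0) 0),
        (fun i => deriv (deriv (fun s => Hsurf x0 y0 z0 phi 0 s i)) 0)]) := by
  have hx := (hx0.differentiable (by simp) 0).hasDerivAt
  have hy := (hy0.differentiable (by simp) 0).hasDerivAt
  rw [h1] at hx
  rw [h2] at hy
  have hp := hphi.differentiable (by simp) 0
  have hdet : Matrix.det (Matrix.of
      ![(fun i => deriv (fun t => Hsurf x0 y0 z0 phi t 0 i) 0),
        (fun i => deriv (fun s => deriv (fun t => Hsurf x0 y0 z0 phi t s i) 0) 0),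
        (fun i => deriv (deriv (fun s => Hsurf x0 y0 z0 phi 0 s i)) 0)])
      = deriv phi 0 * (deriv (deriv z0) 0
        - (x0 0 * deriv (deriv y0) 0 - y0 0 * deriv (deriv x0) 0) / 2) := by
    simp only [deriv_deriv_Hsurf_fst 0 hx hy hp, Hsurf_zero]
    simp only [deriv_Hsurf_fst, Matrix.det_fin_three]
    simp
    linear_combination (deriv phi 0 * (deriv (deriv z0) 0
      - (x0 0 * deriv (deriv y0) 0 - y0 0 * deriv (deriv x0) 0) / 2)) *
      Real.sin_sq_add_cos_sq (phi 0)
  refine ⟨hdet, fun hphi' hz => ?_⟩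
  exact Matrix.linearIndependent_rows_of_det_ne_zero (hdet.trans_ne (mul_ne_zero hphi' hz))
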